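/- arXiv:1210.0352 — 3 statements merged into one kernel-verified Lean document; each statement's English description precedes it below -/
import Mathlib

section
/- If A ⊂ E and the Sobolev capacity C_p(A) = 0, then the variational capacity cap_p(A,E) = 0. (This holds without any additional assumptions on X, because the characteristic function χ_A belongs to N^{1,p}_0(E) and has 0 as an a.e. minimal p-weak upper gradient.) -/
open MeasureTheory Metric Set Filter
open scoped ENNReal NNReal Topology

noncomputable section

variable {X : Type*} [MetricSpace X] [MeasurableSpace X] [BorelSpace X]

/-- A nonconstant, compact, rectifiable curve in `X`, parameterized by arc length on
`[0, len]`. The arc-length parameterization is expressed by requiring that the length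
(total variation) of the curve on each subinterval `[s, t]` equals `t - s`. -/
structure Curve (X : Type*) [MetricSpace X] where
  len : ℝ
  len_pos : 0 < len
  toFun : ℝ → X
  continuousOn : ContinuousOn toFun (Set.Icc 0 len)
  arclength : ∀ s t : ℝ, s ∈ Set.Icc 0 len → t ∈ Set.Icc 0 len → s ≤ t →
    eVariationOn toFun (Set.Icc s t) = ENNReal.ofReal (t - s)
  nonconstant : ∃ s ∈ Set.Icc 0 len, ∃ t ∈ Set.Icc 0 len, toFun s ≠ toFun t

/-- The curve integral `∫_γ g ds` of a nonnegative function along an arc-length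
parameterized curve. -/
def Curve.integral (γ : Curve X) (g : X → ℝ≥0∞) : ℝ≥0∞ :=
  ∫⁻ t in Set.Icc (0 : ℝ) γ.len, g (γ.toFun t)

/-- `|a - b|` with the convention that it is `∞` whenever both `a` and `b` are infinite. -/
def ugDiff (a b : EReal) : ℝ≥0∞ :=
  if a.abs = ⊤ ∨ b.abs = ⊤ then ⊤ else (a - b).abs

/-- The upper gradient inequality for `f` and `g` along the curve `γ`. -/
def UGOn (f : X → EReal) (g : X → ℝ≥0∞) (γ : Curve X) : Prop :=
  ugDiff (f (γ.toFun 0)) (f (γ.toFun γ.len)) ≤ γ.integral g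

/-- A curve family has zero `p`-modulus. -/
def ZeroModulus (p : ℝ) (μ : Measure X) (Γ : Set (Curve X)) : Prop :=
  ∃ ρ : X → ℝ≥0∞, Measurable ρ ∧ (∫⁻ x, ρ x ^ p ∂μ) < ⊤ ∧ ∀ γ ∈ Γ, γ.integral ρ = ⊤

/-- `g` is an upper gradient of `f`. -/
def IsUpperGradient (f : X → EReal) (g : X → ℝ≥0∞) : Prop :=
  Measurable g ∧ ∀ γ : Curve X, UGOn f g γ

/-- `g` is a `p`-weak upper gradient of `f`: the upper gradient inequality holds for
`p`-almost every curve. -/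
def IsWeakUpperGradient (p : ℝ) (μ : Measure X) (f : X → EReal) (g : X → ℝ≥0∞) : Prop :=
  Measurable g ∧ ZeroModulus p μ {γ : Curve X | ¬ UGOn f g γ}

/-- The energy `∫_X g_u^p dμ` of the minimal `p`-weak upper gradient of `u`, expressed as
the infimum of `∫_X g^p dμ` over all `p`-weak upper gradients `g` of `u`
(`= ∞` if `u` has no `p`-weak upper gradient). -/
def gradEnergy (p : ℝ) (μ : Measure X) (u : X → EReal) : ℝ≥0∞ :=
  ⨅ (g : X → ℝ≥0∞) (_ : IsWeakUpperGradient p μ u g), ∫⁻ x, g x ^ p ∂μ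

/-- The Newtonian energy `‖u‖_{N^{1,p}(X)}^p = ∫_X |u|^p dμ + ∫_X g_u^p dμ`. -/
def newtonianEnergy (p : ℝ) (μ : Measure X) (u : X → EReal) : ℝ≥0∞ :=
  (∫⁻ x, (u x).abs ^ p ∂μ) + gradEnergy p μ u

/-- Membership in the Newtonian space `N^{1,p}(X)` (measurability is with respect to the
completion of the Borel σ-algebra, i.e. a.e.-measurability). -/
def MemNewtonian (p : ℝ) (μ : Measure X) (u : X → EReal) : Prop :=
  AEMeasurable u μ ∧ newtonianEnergy p μ u < ⊤

/-- Membership in `N^{1,p}_0(E)`, members being regarded as functions on all of `X`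
that vanish outside `E`. -/
def MemNewtonian0 (p : ℝ) (μ : Measure X) (E : Set X) (u : X → EReal) : Prop :=
  MemNewtonian p μ u ∧ ∀ x ∉ E, u x = 0

/-- The Sobolev capacity `C_p(A)`. -/
def sobolevCapacity (p : ℝ) (μ : Measure X) (A : Set X) : ℝ≥0∞ :=
  ⨅ (u : X → EReal) (_ : MemNewtonian p μ u ∧ ∀ x ∈ A, u x = 1), newtonianEnergy p μ u

/-- The variational capacity `cap_p(A, E)`. -/
def varCapacity (p : ℝ) (μ : Measure X) (A E : Set X) : ℝ≥0∞ :=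
  ⨅ (u : X → EReal) (_ : MemNewtonian0 p μ E u ∧ ∀ x ∈ A, 1 ≤ u x), gradEnergy p μ u

/-- A function is quasicontinuous if outside open sets of arbitrarily small Sobolev
capacity it is real-valued and continuous. -/
def QuasicontinuousFun (p : ℝ) (μ : Measure X) (u : X → EReal) : Prop :=
  ∀ ε : ℝ≥0∞, 0 < ε → ∃ G : Set X, IsOpen G ∧ sobolevCapacity p μ G < ε ∧
    (∀ x ∈ Gᶜ, u x ≠ ⊤ ∧ u x ≠ ⊥) ∧ ContinuousOn u Gᶜ

/-- The capacity `~cap_p(A,E)`: the infimum of `cap_p(G,E)` over all relatively open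
subsets `G` of `E` containing `A`. -/
def varCapacityT (p : ℝ) (μ : Measure X) (A E : Set X) : ℝ≥0∞ :=
  ⨅ (G : Set X) (_ : A ⊆ G ∧ G ⊆ E ∧ ∃ U : Set X, IsOpen U ∧ G = U ∩ E),
    varCapacity p μ G E


theorem EReal.measurable_abs : Measurable EReal.abs :=
  EReal.measurable_of_measurable_real <|
    ENNReal.measurable_ofReal.comp (measurable_id.abs : Measurable fun x : ℝ => |x|)

theorem AEMeasurable.exists_measurable_ge_ae_eq {α : Type*} [MeasurableSpace α] {μ : Measure α}
    {f : α → ℝ≥0∞} (hf : AEMeasurable f μ) :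
    ∃ g : α → ℝ≥0∞, Measurable g ∧ (∀ x, f x ≤ g x) ∧ g =ᵐ[μ] f := by
  classical
  have hnull : μ (toMeasurable μ {x | ¬ f x = hf.mk f x}) = 0 := by
    rw [measure_toMeasurable]
    exact hf.ae_eq_mk
  refine ⟨(toMeasurable μ {x | ¬ f x = hf.mk f x}).piecewise (fun _ => ⊤) (hf.mk f),
    Measurable.piecewise (measurableSet_toMeasurable _ _) measurable_const hf.measurable_mk,
    fun x => ?_, ?_⟩
  · by_cases hx : x ∈ toMeasurable μ {x | ¬ f x = hf.mk f x}
    · simp [hx]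
    · rw [Set.piecewise_eq_of_notMem _ _ _ hx]
      by_contra! hlt
      exact hx (subset_toMeasurable _ _ hlt.ne')
  · have hae : ∀ᵐ x ∂μ, x ∉ toMeasurable μ {x | ¬ f x = hf.mk f x} :=
      measure_eq_zero_iff_ae_notMem.1 hnull
    filter_upwards [hae] with x hx
    rw [Set.piecewise_eq_of_notMem _ _ _ hx]
    by_contra hne
    exact hx (subset_toMeasurable _ _ fun heq => hne heq.symm)

theorem ugDiff_comm (a b : EReal) : ugDiff a b = ugDiff b a := by
  unfold ugDiff
  simp only [or_comm (a := a.abs = ⊤)]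
  split_ifs with h
  · rfl
  · induction a <;> induction b <;> simp_all
    rw [← EReal.coe_sub, ← EReal.coe_sub, EReal.abs_def, EReal.abs_def, abs_sub_comm]

theorem one_le_abs_add_ugDiff_one (a : EReal) : 1 ≤ a.abs + ugDiff a 1 := by
  unfold ugDiff
  split_ifs with h
  · simp
  · induction a with
    | bot => simp
    | top => simp
    | coe r =>
      rw [← EReal.coe_one, ← EReal.coe_sub, EReal.abs_def, EReal.abs_def,
        ← ENNReal.ofReal_add (abs_nonneg _) (abs_nonneg _), ENNReal.one_le_ofReal]
      have h1 := le_abs_self r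
      have h2 := neg_abs_le (r - 1)
      linarith

theorem Curve.integral_mono {Y : Type*} [MetricSpace Y] (γ : Curve Y) {f g : Y → ℝ≥0∞}
    (h : ∀ x, f x ≤ g x) :
    γ.integral f ≤ γ.integral g :=
  lintegral_mono fun t => h (γ.toFun t)

theorem Curve.mul_integral_le_of_mul_le {Y : Type*} [MetricSpace Y] (γ : Curve Y) {f g : Y → ℝ≥0∞}
    {c : ℝ≥0∞}
    (h : ∀ x, c * f x ≤ g x) : c * γ.integral f ≤ γ.integral g :=
  (lintegral_const_mul_le c _).trans (γ.integral_mono h)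

/-- The restriction of a curve to `[a, b]`, reparameterized on `[0, b - a]`. -/
def Curve.restrict (γ : Curve X) (a b : ℝ) (ha : 0 ≤ a) (hab : a < b) (hb : b ≤ γ.len)
    (hne : γ.toFun a ≠ γ.toFun b) : Curve X where
  len := b - a
  len_pos := sub_pos.2 hab
  toFun t := γ.toFun (a + t)
  continuousOn := γ.continuousOn.comp (by fun_prop) fun t ht =>
    ⟨by linarith [ht.1], by linarith [ht.2]⟩
  arclength s t hs ht hst := by
    have hcomp := eVariationOn.comp_eq_of_monotoneOn γ.toFun (t := Set.Icc s t) (fun r => a + r)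
      fun x _ y _ hxy => by simpa using hxy
    rw [Set.image_const_add_Icc, γ.arclength (a + s) (a + t)
      ⟨by linarith [hs.1], by linarith [hs.2]⟩ ⟨by linarith [ht.1], by linarith [ht.2]⟩
      (by linarith), add_sub_add_left_eq_sub] at hcomp
    exact hcomp
  nonconstant := ⟨0, ⟨le_rfl, by linarith⟩, b - a, ⟨by linarith, le_rfl⟩, by simpa using hne⟩

theorem Curve.integral_restrict_le {Y : Type*} [MetricSpace Y] (γ : Curve Y) {a b : ℝ}
    (ha : 0 ≤ a) (hab : a < b)
    (hb : b ≤ γ.len) (hne : γ.toFun a ≠ γ.toFun b) (f : Y → ℝ≥0∞) :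
    (γ.restrict a b ha hab hb hne).integral f ≤ γ.integral f := by
  have hpre := (measurePreserving_add_left volume a).setLIntegral_comp_preimage_emb
    (measurableEmbedding_addLeft a) (fun t => f (γ.toFun t)) (Set.Icc a b)
  rw [Set.preimage_const_add_Icc, sub_self] at hpre
  exact hpre.le.trans (lintegral_mono_set (Set.Icc_subset_Icc ha hb))

theorem Curve.ugDiff_le_of_forall_ugOn {Y : Type*} [MetricSpace Y] {f : Y → EReal} {g : Y → ℝ≥0∞}
    (hg : ∀ γ : Curve Y, UGOn f g γ) (γ : Curve Y) {s t : ℝ} (hs : s ∈ Set.Icc 0 γ.len)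
    (ht : t ∈ Set.Icc 0 γ.len) (hne : γ.toFun s ≠ γ.toFun t) :
    ugDiff (f (γ.toFun s)) (f (γ.toFun t)) ≤ γ.integral g := by
  rcases lt_trichotomy s t with hst | rfl | hst
  · have h := (hg (γ.restrict s t hs.1 hst ht.2 hne)).trans (γ.integral_restrict_le _ _ _ _ g)
    simpa [Curve.restrict] using h
  · exact absurd rfl hne
  · have h := (hg (γ.restrict t s ht.1 hst hs.2 hne.symm)).trans
      (γ.integral_restrict_le _ _ _ _ g)
    rw [ugDiff_comm]
    simpa [Curve.restrict] using h

theorem Curve.aemeasurable_comp (γ : Curve X) {f : X → ℝ≥0∞} (hf : Measurable f) :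
    AEMeasurable (fun t => f (γ.toFun t)) (volume.restrict (Set.Icc 0 γ.len)) :=
  hf.comp_aemeasurable (γ.continuousOn.aemeasurable measurableSet_Icc)

/-- A curve along which `f` has finite integral has a parameter at which `f` is finite. -/
theorem Curve.exists_lt_top_of_integral_ne_top (γ : Curve X) {f : X → ℝ≥0∞} (hf : Measurable f)
    (h : γ.integral f ≠ ⊤) : ∃ t ∈ Set.Icc 0 γ.len, f (γ.toFun t) < ⊤ := by
  have hae := ae_lt_top' (γ.aemeasurable_comp hf) h
  by_contra! hall
  have hvol : volume (Set.Icc 0 γ.len) = 0 := by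
    rw [ae_restrict_iff' measurableSet_Icc] at hae
    refine measure_mono_null (fun t ht => ?_) hae
    exact fun himp => (himp ht).not_ge (hall t ht)
  rw [Real.volume_Icc, sub_zero, ENNReal.ofReal_eq_zero] at hvol
  exact hvol.not_gt γ.len_pos

/-- A function of small Newtonian energy is dominated by a Borel function of small `p`-energy
which is also an upper gradient of it. -/
theorem exists_isUpperGradient_abs_le {Y : Type*} [MetricSpace Y] [MeasurableSpace Y] {p : ℝ}
    (hp : 0 < p) {μ : Measure Y} {u : Y → EReal} (hu : AEMeasurable u μ)
    {δ : ℝ≥0∞} (hδ : newtonianEnergy p μ u < δ) :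
    ∃ F : Y → ℝ≥0∞, IsUpperGradient u F ∧ (∀ x, (u x).abs ≤ F x) ∧ ∫⁻ x, F x ^ p ∂μ < δ := by
  obtain ⟨h, hmeas, hle, hae⟩ :=
    (EReal.measurable_abs.comp_aemeasurable hu).exists_measurable_ge_ae_eq
  have hint : ∫⁻ x, h x ^ p ∂μ = ∫⁻ x, (u x).abs ^ p ∂μ :=
    lintegral_congr_ae (hae.mono fun x hx => by simp only [hx, Function.comp_apply])
  rw [newtonianEnergy, ← lt_tsub_iff_left] at hδ
  simp only [gradEnergy, iInf_lt_iff] at hδ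
  obtain ⟨g, ⟨hg, ρ, hρ, hρfin, hρtop⟩, hgδ⟩ := hδ
  rw [lt_tsub_iff_left, ← hint] at hgδ
  obtain ⟨c, hc, hcδ⟩ := ENNReal.exists_nnreal_pos_mul_lt hρfin.ne (tsub_pos_of_lt hgδ).ne'
  rw [lt_tsub_iff_left] at hcδ
  have hF : ∀ x, ((h x ^ p + g x ^ p + c * ρ x ^ p) ^ p⁻¹) ^ p
      = h x ^ p + g x ^ p + c * ρ x ^ p := fun x => ENNReal.rpow_inv_rpow hp.ne' _
  refine ⟨fun x => (h x ^ p + g x ^ p + c * ρ x ^ p) ^ p⁻¹, ⟨by fun_prop, fun γ => ?_⟩,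
    fun x => ?_, ?_⟩
  · by_cases hγ : UGOn u g γ
    · refine le_trans hγ (γ.integral_mono fun x => ?_)
      rw [ENNReal.le_rpow_inv_iff hp]
      exact le_add_self.trans le_self_add
    · have hmul := γ.mul_integral_le_of_mul_le (f := ρ) (c := (c : ℝ≥0∞) ^ p⁻¹)
        (g := fun x => (h x ^ p + g x ^ p + c * ρ x ^ p) ^ p⁻¹) fun x => by
          rw [ENNReal.le_rpow_inv_iff hp, ENNReal.mul_rpow_of_nonneg _ _ hp.le,
            ENNReal.rpow_inv_rpow hp.ne']
          exact le_add_self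
      rw [hρtop γ hγ, ENNReal.mul_top (ENNReal.rpow_pos (by simpa using hc) (by simp)).ne',
        top_le_iff] at hmul
      rw [UGOn, hmul]
      exact le_top
  · rw [ENNReal.le_rpow_inv_iff hp]
    calc (u x).abs ^ p ≤ h x ^ p := ENNReal.rpow_le_rpow (hle x) hp.le
      _ ≤ _ := le_self_add.trans le_self_add
  · simp only [hF]
    rw [lintegral_add_left (by fun_prop), lintegral_add_left (by fun_prop),
      lintegral_const_mul _ (by fun_prop)]
    exact hcδ

/-- A set of zero Sobolev capacity is contained in the infinity set of a Borel function in
`L^p` whose integral is infinite along every curve meeting the set. -/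
theorem exists_integral_eq_top_of_sobolevCapacity_eq_zero {p : ℝ} (hp : 0 < p) {μ : Measure X}
    {A : Set X} (h : sobolevCapacity p μ A = 0) :
    ∃ ρ : X → ℝ≥0∞, Measurable ρ ∧ ∫⁻ x, ρ x ^ p ∂μ < ⊤ ∧ (∀ x ∈ A, ρ x = ⊤) ∧
      ∀ γ : Curve X, (∃ t ∈ Set.Icc 0 γ.len, γ.toFun t ∈ A) → γ.integral ρ = ⊤ := by
  obtain ⟨ε, hε, hεsum⟩ := ENNReal.exists_pos_sum_of_countable one_ne_zero ℕ
  have hex : ∀ n : ℕ, ∃ u : X → EReal, (∀ x ∈ A, u x = 1) ∧ ∃ F : X → ℝ≥0∞,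
      IsUpperGradient u F ∧ (∀ x, (u x).abs ≤ F x) ∧
        ∫⁻ x, F x ^ p ∂μ < ε n / (n : ℝ≥0∞) ^ p := by
    intro n
    have hpos : sobolevCapacity p μ A < ε n / (n : ℝ≥0∞) ^ p := by
      rw [h]
      exact ENNReal.div_pos (by simpa using (hε n).ne')
        (ENNReal.rpow_ne_top_of_nonneg hp.le (ENNReal.natCast_ne_top n))
    simp only [sobolevCapacity, iInf_lt_iff] at hpos
    obtain ⟨u, ⟨hu, huA⟩, huε⟩ := hpos
    exact ⟨u, huA, exists_isUpperGradient_abs_le hp hu.1 huε⟩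
  choose u huA F hF huF hFε using hex
  have hFm : ∀ n, Measurable (F n) := fun n => (hF n).1
  set ρ : X → ℝ≥0∞ := fun x => (∑' n : ℕ, ((n : ℝ≥0∞) * F n x) ^ p) ^ p⁻¹ with hρ_def
  have hρm : Measurable ρ := by
    have hterm : ∀ n : ℕ, Measurable fun x => ((n : ℝ≥0∞) * F n x) ^ p := fun n => by fun_prop
    exact (Measurable.tsum hterm).pow_const _
  have hle : ∀ (n : ℕ) (x : X), (n : ℝ≥0∞) * F n x ≤ ρ x := fun n x => by
    rw [hρ_def, ENNReal.le_rpow_inv_iff hp]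
    exact ENNReal.le_tsum n
  have hρA : ∀ x ∈ A, ρ x = ⊤ := fun x hx => by
    refine ENNReal.eq_top_of_forall_nnreal_le fun r => ?_
    obtain ⟨n, hn⟩ := exists_nat_ge r
    have h1 : 1 ≤ F n x := by
      have h2 := huF n x
      rw [huA n x hx] at h2
      rw [← EReal.coe_one, EReal.abs_def] at h2
      simpa using h2
    calc (r : ℝ≥0∞) ≤ n * 1 := by simpa using mod_cast hn
      _ ≤ n * F n x := by gcongr
      _ ≤ ρ x := hle n x
  refine ⟨ρ, hρm, ?_, hρA, ?_⟩
  · have hpow : ∀ x, ρ x ^ p = ∑' n : ℕ, ((n : ℝ≥0∞) * F n x) ^ p := fun x =>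
      ENNReal.rpow_inv_rpow hp.ne' _
    simp only [hpow]
    rw [lintegral_tsum fun n => by fun_prop]
    refine lt_of_le_of_lt (ENNReal.tsum_le_tsum fun n => ?_) (hεsum.trans ENNReal.one_lt_top)
    simp only [ENNReal.mul_rpow_of_nonneg _ _ hp.le]
    rw [lintegral_const_mul _ (by fun_prop)]
    calc (n : ℝ≥0∞) ^ p * ∫⁻ x, F n x ^ p ∂μ ≤ (n : ℝ≥0∞) ^ p * (ε n / (n : ℝ≥0∞) ^ p) := by
          gcongr
          exact (hFε n).le
      _ ≤ ε n := ENNReal.mul_div_le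
  · rintro γ ⟨t, ht, htA⟩
    by_contra hfin
    obtain ⟨s, hs, hsfin⟩ := γ.exists_lt_top_of_integral_ne_top hρm hfin
    have hne : γ.toFun s ≠ γ.toFun t := fun heq => by
      rw [heq, hρA _ htA] at hsfin
      exact lt_irrefl _ hsfin
    obtain ⟨n, hn⟩ := ENNReal.exists_nat_gt (ENNReal.add_ne_top.2 ⟨hsfin.ne, hfin⟩)
    refine hn.not_ge ?_
    have hug := γ.ugDiff_le_of_forall_ugOn (hF n).2 hs ht hne
    rw [huA n _ htA] at hug
    calc (n : ℝ≥0∞) = n * 1 := (mul_one _).symm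
      _ ≤ n * (F n (γ.toFun s) + γ.integral (F n)) := by
          gcongr
          exact (one_le_abs_add_ugDiff_one _).trans (add_le_add (huF n _) hug)
      _ = n * F n (γ.toFun s) + n * γ.integral (F n) := mul_add _ _ _
      _ ≤ ρ (γ.toFun s) + γ.integral ρ :=
          add_le_add (hle n _) (γ.mul_integral_le_of_mul_le (hle n))

/-- If `A ⊆ E` and `C_p(A) = 0`, then `cap_p(A,E) = 0`
(no additional assumptions on `X`). -/
theorem stmt_0 (p : ℝ) (hp : 1 ≤ p) (μ : Measure X)
    (hball : ∀ (x : X) (r : ℝ), 0 < r → 0 < μ (Metric.ball x r) ∧ μ (Metric.ball x r) < ⊤)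
    (E : Set X) (hE : Bornology.IsBounded E) (A : Set X) (hAE : A ⊆ E)
    (h : sobolevCapacity p μ A = 0) :
    varCapacity p μ A E = 0 := by
  have hp0 : 0 < p := zero_lt_one.trans_le hp
  obtain ⟨ρ, hρm, hρfin, hρA, hργ⟩ := exists_integral_eq_top_of_sobolevCapacity_eq_zero hp0 h
  have hAnull : μ A = 0 := by
    refine measure_mono_null (fun x hx => ?_)
      (ae_lt_top (hρm.pow_const p) hρfin.ne : ∀ᵐ x ∂μ, ρ x ^ p < ⊤)
    simp [hρA x hx, hp0]
  have hu0 : A.indicator (fun _ => (1 : EReal)) =ᵐ[μ] fun _ => 0 :=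
    indicator_meas_zero hAnull
  have hug : IsWeakUpperGradient p μ (A.indicator fun _ => (1 : EReal)) fun _ => 0 := by
    refine ⟨measurable_const, ρ, hρm, hρfin, fun γ hγ => hργ γ ?_⟩
    by_contra! hall
    refine hγ ?_
    have hlen := γ.len_pos.le
    simp [UGOn, ugDiff, hall 0 ⟨le_rfl, hlen⟩, hall γ.len ⟨hlen, le_rfl⟩]
  have hgrad : gradEnergy p μ (A.indicator fun _ => (1 : EReal)) = 0 :=
    nonpos_iff_eq_zero.1 ((iInf₂_le _ hug).trans (by simp [ENNReal.zero_rpow_of_pos hp0]))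
  have habs : ∫⁻ x, (A.indicator (fun _ => (1 : EReal)) x).abs ^ p ∂μ = 0 := by
    rw [lintegral_congr_ae (hu0.mono fun x hx => by rw [hx])]
    simp [ENNReal.zero_rpow_of_pos hp0]
  refine nonpos_iff_eq_zero.1 ((iInf₂_le (A.indicator fun _ => (1 : EReal)) ?_).trans hgrad.le)
  refine ⟨⟨⟨aemeasurable_const.congr hu0.symm, ?_⟩, fun x hx => ?_⟩, fun x hx => ?_⟩
  · simp [newtonianEnergy, hgrad, habs]
  · exact indicator_of_notMem (fun hxA => hx (hAE hxA)) _
  · simp [hx]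

end
end

section
/- Assume that X supports a (p,p)-Poincaré inequality for N^{1,p}_0 and that C_p(X \ E) > 0. Then for every A ⊂ E: C_p(A) = 0 if and only if cap_p(A,E) = 0. -/
open MeasureTheory Metric Set Filter
open scoped ENNReal NNReal Topology

noncomputable section

variable {X : Type*} [MetricSpace X] [MeasurableSpace X] [BorelSpace X]

/-- `X` supports a `(p,p)`-Poincaré inequality for `N^{1,p}_0`. -/
def PoincareN0 (p : ℝ) (μ : Measure X) : Prop :=
  ∀ E : Set X, Bornology.IsBounded E → 0 < sobolevCapacity p μ Eᶜ →
    ∃ C : ℝ≥0, 0 < C ∧ ∀ u : X → EReal, MemNewtonian0 p μ E u →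
      (∫⁻ x, (u x).abs ^ p ∂μ) ≤ (C : ℝ≥0∞) * gradEnergy p μ u

theorem abs_le_abs_add_ugDiff (a b : EReal) : a.abs ≤ b.abs + ugDiff a b := by
  unfold ugDiff
  split_ifs with h
  · simp
  · push Not at h
    induction a <;> induction b <;> simp_all
    rename_i x y
    rw [← EReal.coe_sub, EReal.abs_def, EReal.abs_def, EReal.abs_def,
      ← ENNReal.ofReal_add (abs_nonneg _) (abs_nonneg _)]
    refine ENNReal.ofReal_le_ofReal ?_
    calc |x| = |y + (x - y)| := by ring_nf
      _ ≤ |y| + |x - y| := abs_add_le _ _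

theorem ugDiff_min_one_le (a b : EReal) : ugDiff (min a 1) (min b 1) ≤ ugDiff a b := by
  by_cases h : a.abs = ⊤ ∨ b.abs = ⊤
  · simp [ugDiff, h]
  · push Not at h
    induction a <;> induction b <;> simp_all
    rename_i x y
    rw [← EReal.coe_one, ← EReal.coe_strictMono.monotone.map_min, ← EReal.coe_strictMono.monotone.map_min]
    simp only [ugDiff, EReal.abs_def, ENNReal.ofReal_ne_top, or_self, if_false, ← EReal.coe_sub]
    exact ENNReal.ofReal_le_ofReal (by
      simpa using abs_min_sub_min_le_max x 1 y 1)

theorem EReal.abs_min_one_le (a : EReal) : (min a 1).abs ≤ a.abs := by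
  induction a with
  | bot => simp
  | top => simp
  | coe x =>
    rw [← EReal.coe_one, ← EReal.coe_strictMono.monotone.map_min, EReal.abs_def, EReal.abs_def]
    refine ENNReal.ofReal_le_ofReal ?_
    rcases le_total x 1 with h | h
    · rw [min_eq_left h]
    · rw [min_eq_right h, abs_one]
      exact h.trans (le_abs_self x)

theorem gradEnergy_min_one_le (p : ℝ) (μ : Measure X) (u : X → EReal) :
    gradEnergy p μ (fun x => min (u x) 1) ≤ gradEnergy p μ u := by
  refine le_iInf₂ fun g hg => iInf₂_le g ⟨hg.1, ?_⟩
  obtain ⟨ρ, hρ, hfin, hΓ⟩ := hg.2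
  exact ⟨ρ, hρ, hfin, fun γ hγ => hΓ γ fun h => hγ ((ugDiff_min_one_le _ _).trans h)⟩

/-- The restriction of a curve to a nondegenerate subinterval. -/
def Curve.subcurve (γ : Curve X) (a b : ℝ) (ha : 0 ≤ a) (hab : a < b) (hb : b ≤ γ.len) :
    Curve X where
  len := b - a
  len_pos := sub_pos.2 hab
  toFun r := γ.toFun (a + r)
  continuousOn := γ.continuousOn.comp (by fun_prop) fun r hr =>
    ⟨by linarith [hr.1], by linarith [hr.2]⟩
  arclength s t hs ht hst := by
    have h := γ.arclength (a + s) (a + t) ⟨by linarith [hs.1], by linarith [hs.2]⟩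
      ⟨by linarith [ht.1], by linarith [ht.2]⟩ (by linarith)
    rw [add_sub_add_left_eq_sub, ← Set.image_const_add_Icc] at h
    rw [← h]
    exact eVariationOn.comp_eq_of_monotoneOn γ.toFun (fun r => a + r)
      fun x _ y _ hxy => by simpa using hxy
  nonconstant := by
    by_contra! hcon
    have h := γ.arclength a b ⟨ha, by linarith⟩ ⟨by linarith, hb⟩ hab.le
    rw [eVariationOn.constant_on] at h
    · exact (ENNReal.ofReal_pos.2 (sub_pos.2 hab)).ne h
    · rintro _ ⟨s, hs, rfl⟩ _ ⟨t, ht, rfl⟩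
      simpa using hcon (s - a) ⟨by linarith [hs.1], by linarith [hs.2]⟩
        (t - a) ⟨by linarith [ht.1], by linarith [ht.2]⟩

theorem Curve.integral_subcurve_le (γ : Curve X) (a b : ℝ) (ha : 0 ≤ a) (hab : a < b)
    (hb : b ≤ γ.len) (g : X → ℝ≥0∞) :
    (γ.subcurve a b ha hab hb).integral g ≤ γ.integral g := by
  have h := (measurePreserving_add_left volume a).setLIntegral_comp_emb
    (measurableEmbedding_addLeft a) (fun t => g (γ.toFun t)) (Set.Icc 0 (b - a))
  rw [Set.image_const_add_Icc] at h
  calc (γ.subcurve a b ha hab hb).integral g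
      = ∫⁻ t in Set.Icc (a + 0) (a + (b - a)), g (γ.toFun t) := by
        rw [← h]; simp only [Curve.integral, Curve.subcurve]
    _ ≤ γ.integral g := lintegral_mono_set (Set.Icc_subset_Icc (by linarith) (by linarith))

theorem IsUpperGradient.ugDiff_le {u : X → EReal} {g : X → ℝ≥0∞} (hg : IsUpperGradient u g)
    (γ : Curve X) {s t : ℝ} (hs : s ∈ Set.Icc 0 γ.len) (ht : t ∈ Set.Icc 0 γ.len)
    (hst : s ≠ t) : ugDiff (u (γ.toFun s)) (u (γ.toFun t)) ≤ γ.integral g := by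
  wlog h : s < t generalizing s t
  · rw [ugDiff_comm]
    exact this ht hs hst.symm (hst.lt_or_gt.resolve_left h)
  · have := (hg.2 (γ.subcurve s t hs.1 h ht.2)).trans (γ.integral_subcurve_le s t hs.1 h ht.2 g)
    simpa [Curve.subcurve] using this

/-- If `|u| = 1` at a point of a curve, then the curve integrals of a majorant of `|u|` and of an
upper gradient of `u` cannot both be small. -/
theorem IsUpperGradient.ofReal_len_le {u : X → EReal} {g h : X → ℝ≥0∞}
    (hg : IsUpperGradient u g) (hh : ∀ x, (u x).abs ≤ h x) (γ : Curve X) {s : ℝ}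
    (hs : s ∈ Set.Icc 0 γ.len) (hu : u (γ.toFun s) = 1) :
    ENNReal.ofReal γ.len ≤ γ.integral h + γ.integral g * ENNReal.ofReal γ.len := by
  have h1 : (1 : EReal).abs = 1 := by
    rw [← EReal.coe_one, EReal.abs_def]; simp
  have key : ∀ t ∈ Set.Icc 0 γ.len, (1 : ℝ≥0∞) ≤ h (γ.toFun t) + γ.integral g := by
    intro t ht
    rw [← h1, ← hu]
    rcases eq_or_ne s t with rfl | hst
    · exact (hh _).trans le_self_add
    · exact (abs_le_abs_add_ugDiff _ (u (γ.toFun t))).trans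
        (add_le_add (hh _) (hg.ugDiff_le γ hs ht hst))
  have := setLIntegral_mono' (μ := volume) measurableSet_Icc key
  rw [lintegral_add_right _ measurable_const] at this
  simpa [Curve.integral] using this

theorem AEMeasurable.exists_measurable_abs_le {Y : Type*} [MeasurableSpace Y] {μ : Measure Y}
    {u : Y → EReal} (hu : AEMeasurable u μ) :
    ∃ h : Y → ℝ≥0∞, Measurable h ∧ (∀ x, (u x).abs ≤ h x) ∧ h =ᵐ[μ] fun x => (u x).abs := by
  classical
  obtain ⟨N, hsub, hN, hN0⟩ := exists_measurable_superset_of_null hu.ae_eq_mk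
  refine ⟨N.piecewise (fun _ => ⊤) (fun x => (hu.mk u x).abs),
    measurable_const.piecewise hN (EReal.measurable_abs.comp hu.measurable_mk), fun x => ?_, ?_⟩
  · by_cases hx : x ∈ N
    · simp [hx]
    · have : u x = hu.mk u x := by
        by_contra hne
        exact hx (hsub hne)
      simp [hx, this]
  · have hN' : ∀ᵐ x ∂μ, x ∉ N := measure_eq_zero_iff_ae_notMem.1 hN0
    filter_upwards [hN', hu.ae_eq_mk] with x hx hux
    simp [hx, hux]

/-- A `p`-weak upper gradient can be replaced by an upper gradient with nearly the same energy. -/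
theorem IsWeakUpperGradient.exists_isUpperGradient {p : ℝ} (hp : 0 < p) {μ : Measure X}
    {u : X → EReal} {g : X → ℝ≥0∞} (hg : IsWeakUpperGradient p μ u g) {δ : ℝ≥0∞}
    (hδ : ∫⁻ x, g x ^ p ∂μ < δ) :
    ∃ g', IsUpperGradient u g' ∧ ∫⁻ x, g' x ^ p ∂μ < δ := by
  obtain ⟨hgm, ρ, hρ, hfin, hΓ⟩ := hg
  obtain ⟨η, hη, hηlt⟩ := ENNReal.exists_nnreal_pos_mul_lt hfin.ne (tsub_pos_of_lt hδ).ne'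
  have hη0 : (η : ℝ≥0∞) ^ p⁻¹ ≠ 0 := by
    simp [ENNReal.rpow_eq_zero_iff, hη.ne']
  refine ⟨fun x => (g x ^ p + η * ρ x ^ p) ^ p⁻¹, ⟨by fun_prop, fun γ => ?_⟩, ?_⟩
  · by_cases h : UGOn u g γ
    · refine h.trans (lintegral_mono fun t => ?_)
      calc g (γ.toFun t) = (g (γ.toFun t) ^ p) ^ p⁻¹ := (ENNReal.rpow_rpow_inv hp.ne' _).symm
        _ ≤ _ := ENNReal.rpow_le_rpow le_self_add (inv_nonneg.2 hp.le)
    · refine le_of_le_of_eq le_top (Eq.symm (top_le_iff.1 ?_))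
      calc ⊤ = (η : ℝ≥0∞) ^ p⁻¹ * γ.integral ρ := by rw [hΓ γ h, ENNReal.mul_top hη0]
        _ ≤ ∫⁻ t in Set.Icc 0 γ.len, (η : ℝ≥0∞) ^ p⁻¹ * ρ (γ.toFun t) :=
          lintegral_const_mul_le _ _
        _ ≤ _ := lintegral_mono fun t => by
          calc (η : ℝ≥0∞) ^ p⁻¹ * ρ (γ.toFun t)
              = (η * ρ (γ.toFun t) ^ p) ^ p⁻¹ := by
                rw [ENNReal.mul_rpow_of_nonneg _ _ (inv_nonneg.2 hp.le),
                  ENNReal.rpow_rpow_inv hp.ne']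
            _ ≤ _ := ENNReal.rpow_le_rpow le_add_self (inv_nonneg.2 hp.le)
  · simp only [ENNReal.rpow_inv_rpow hp.ne']
    rw [lintegral_add_left (by fun_prop), lintegral_const_mul _ (by fun_prop)]
    calc _ < ∫⁻ x, g x ^ p ∂μ + (δ - ∫⁻ x, g x ^ p ∂μ) :=
          ENNReal.add_lt_add_left (ne_top_of_lt hδ) hηlt
      _ = δ := add_tsub_cancel_of_le hδ.le

theorem exists_isUpperGradient_of_sobolevCapacity_eq_zero {p : ℝ} (hp : 0 < p) {μ : Measure X}
    {A : Set X} (hA : sobolevCapacity p μ A = 0) {δ : ℝ≥0∞} (hδ : 0 < δ) :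
    ∃ (u : X → EReal) (h g : X → ℝ≥0∞), (∀ x ∈ A, u x = 1) ∧ Measurable h ∧
      (∀ x, (u x).abs ≤ h x) ∧ IsUpperGradient u g ∧
      ∫⁻ x, h x ^ p ∂μ < δ ∧ ∫⁻ x, g x ^ p ∂μ < δ := by
  rw [← hA] at hδ
  obtain ⟨u, ⟨⟨hum, -⟩, huA⟩, hu⟩ : ∃ u : X → EReal,
      (MemNewtonian p μ u ∧ ∀ x ∈ A, u x = 1) ∧ newtonianEnergy p μ u < δ := by
    simpa only [sobolevCapacity, iInf_lt_iff, exists_prop] using hδ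
  obtain ⟨g₀, hg₀, hlt⟩ : ∃ g, IsWeakUpperGradient p μ u g ∧ ∫⁻ x, g x ^ p ∂μ < δ := by
    simpa only [gradEnergy, iInf_lt_iff, exists_prop] using lt_of_le_of_lt le_add_self hu
  obtain ⟨g, hg, hgδ⟩ := hg₀.exists_isUpperGradient hp hlt
  obtain ⟨h, hh, hle, hae⟩ := hum.exists_measurable_abs_le
  refine ⟨u, h, g, huA, hh, hle, hg, ?_, hgδ⟩
  exact (lintegral_congr_ae (hae.fun_comp (· ^ p))).trans_lt (lt_of_le_of_lt le_self_add hu)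

theorem measure_eq_zero_of_sobolevCapacity_eq_zero {p : ℝ} (hp : 0 < p) {μ : Measure X}
    {A : Set X} (hA : sobolevCapacity p μ A = 0) : μ A = 0 := by
  refine le_antisymm (le_of_forall_pos_le_add fun δ hδ => ?_) zero_le
  obtain ⟨u, h, g, huA, hh, hle, -, hlt, -⟩ :=
    exists_isUpperGradient_of_sobolevCapacity_eq_zero hp hA hδ
  rw [zero_add]
  have hsub : A ⊆ {x | 1 ≤ h x ^ p} := fun x hx => by
    have h1 : (1 : ℝ≥0∞) ≤ h x := by
      have := hle x
      rwa [huA x hx, ← EReal.coe_one, EReal.abs_def, abs_one, ENNReal.ofReal_one] at this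
    exact ENNReal.one_le_rpow h1 hp
  calc μ A ≤ 1 * μ {x | 1 ≤ h x ^ p} := by rw [one_mul]; exact measure_mono hsub
    _ ≤ ∫⁻ x, h x ^ p ∂μ := mul_meas_ge_le_lintegral (by fun_prop) 1
    _ ≤ δ := hlt.le

/-- Almost every curve avoids a set of zero Sobolev capacity. -/
theorem zeroModulus_of_sobolevCapacity_eq_zero {p : ℝ} (hp : 0 < p) {μ : Measure X}
    {A : Set X} (hA : sobolevCapacity p μ A = 0) :
    ZeroModulus p μ {γ : Curve X | ∃ s ∈ Set.Icc 0 γ.len, γ.toFun s ∈ A} := by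
  obtain ⟨δ, hδ, hsum⟩ := ENNReal.exists_pos_tsum_mul_lt_of_countable one_ne_zero
    (fun j : ℕ => ((j : ℝ≥0∞) ^ p)) (fun j => by simp [ENNReal.rpow_eq_top_iff, hp.not_gt])
  choose u h g huA hh hle hg hhδ hgδ using fun j : ℕ =>
    exists_isUpperGradient_of_sobolevCapacity_eq_zero hp hA (ENNReal.coe_pos.2 (hδ j))
  have hgm : ∀ j, Measurable (g j) := fun j => (hg j).1
  set S : X → ℝ≥0∞ := fun x => ∑' j : ℕ, (j : ℝ≥0∞) ^ p * (h j x ^ p + g j x ^ p) with hS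
  have hSm : Measurable S := by fun_prop
  have hbound : ∀ (j : ℕ) (f : X → ℝ≥0∞), (∀ x, f x ^ p ≤ h j x ^ p + g j x ^ p) →
      ∀ x, (j : ℝ≥0∞) * f x ≤ S x ^ p⁻¹ := by
    intro j f hf x
    rw [ENNReal.le_rpow_inv_iff hp, ENNReal.mul_rpow_of_nonneg _ _ hp.le]
    exact (mul_le_mul_right (hf x) _).trans (ENNReal.le_tsum j)
  refine ⟨fun x => S x ^ p⁻¹, by fun_prop, ?_, ?_⟩
  · simp only [ENNReal.rpow_inv_rpow hp.ne', hS]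
    rw [lintegral_tsum (fun j => by fun_prop)]
    calc ∑' j : ℕ, ∫⁻ x, (j : ℝ≥0∞) ^ p * (h j x ^ p + g j x ^ p) ∂μ
        ≤ ∑' j : ℕ, 2 * ((j : ℝ≥0∞) ^ p * δ j) := ENNReal.tsum_le_tsum fun j => by
          rw [lintegral_const_mul _ (by fun_prop), lintegral_add_left (by fun_prop),
            mul_left_comm, two_mul]
          exact mul_le_mul_right (add_le_add (hhδ j).le (hgδ j).le) _
      _ = 2 * ∑' j : ℕ, ((j : ℝ≥0∞) ^ p * δ j) := ENNReal.tsum_mul_left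
      _ < ⊤ := ENNReal.mul_lt_top (by simp) (hsum.trans ENNReal.one_lt_top)
  · rintro γ ⟨s, hs, hsA⟩
    set I := γ.integral fun x => S x ^ p⁻¹
    set L := ENNReal.ofReal γ.len
    have hL : 0 < L := ENNReal.ofReal_pos.2 γ.len_pos
    have hint : ∀ (j : ℕ) (f : X → ℝ≥0∞), (∀ x, f x ^ p ≤ h j x ^ p + g j x ^ p) →
        (j : ℝ≥0∞) * γ.integral f ≤ I := fun j f hf =>
      (lintegral_const_mul_le _ _).trans (lintegral_mono fun t => hbound j f hf _)
    have hle : ∀ j : ℕ, (j : ℝ≥0∞) * L ≤ I + I * L := fun j => by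
      calc (j : ℝ≥0∞) * L
          ≤ j * (γ.integral (h j) + γ.integral (g j) * L) :=
            mul_le_mul_right ((hg j).ofReal_len_le (hle j) γ hs (huA j _ hsA)) _
        _ = j * γ.integral (h j) + j * γ.integral (g j) * L := by ring
        _ ≤ I + I * L := add_le_add (hint j _ fun x => le_self_add)
            (mul_le_mul_left (hint j _ fun x => le_add_self) _)
    by_contra hI
    have hK : I + I * L ≠ ⊤ :=
      ENNReal.add_ne_top.2 ⟨hI, ENNReal.mul_ne_top hI ENNReal.ofReal_ne_top⟩
    obtain ⟨n, hn⟩ := ENNReal.exists_nat_mul_gt hL.ne' hK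
    exact absurd hn (not_lt.2 (hle n))

theorem varCapacity_eq_zero_of_sobolevCapacity_eq_zero {p : ℝ} (hp : 0 < p) {μ : Measure X}
    {A E : Set X} (hAE : A ⊆ E) (hA : sobolevCapacity p μ A = 0) : varCapacity p μ A E = 0 := by
  classical
  set v : X → EReal := A.indicator 1
  have hv : v =ᵐ[μ] 0 := by
    have : ∀ᵐ x ∂μ, x ∉ A :=
      measure_eq_zero_iff_ae_notMem.1 (measure_eq_zero_of_sobolevCapacity_eq_zero hp hA)
    filter_upwards [this] with x hx
    simp [v, hx]
  have hgrad : gradEnergy p μ v = 0 := by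
    have hw : IsWeakUpperGradient p μ v 0 := by
      refine ⟨measurable_zero, ?_⟩
      obtain ⟨ρ, hρ, hfin, hΓ⟩ := zeroModulus_of_sobolevCapacity_eq_zero hp hA
      refine ⟨ρ, hρ, hfin, fun γ hγ => hΓ γ ?_⟩
      by_contra hcon
      have hcon' : ∀ s ∈ Set.Icc 0 γ.len, γ.toFun s ∉ A := fun s hs hsA => hcon ⟨s, hs, hsA⟩
      have h0 := hcon' 0 ⟨le_rfl, γ.len_pos.le⟩
      have h1 := hcon' γ.len ⟨γ.len_pos.le, le_rfl⟩
      exact hγ (by simp [UGOn, ugDiff, v, h0, h1])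
    exact le_antisymm ((iInf₂_le (0 : X → ℝ≥0∞) hw).trans (by simp [hp])) zero_le
  have hmem : MemNewtonian p μ v := by
    refine ⟨(aemeasurable_const (b := (0 : EReal))).congr hv.symm, ?_⟩
    have : ∫⁻ x, (v x).abs ^ p ∂μ = 0 := by
      refine (lintegral_congr_ae (hv.fun_comp fun a => a.abs ^ p)).trans ?_
      simp [hp]
    simp [newtonianEnergy, hgrad, this]
  refine le_antisymm (hgrad ▸ iInf₂_le v ⟨⟨hmem, fun x hx => ?_⟩, fun x hx => ?_⟩) zero_le
  · exact Set.indicator_of_notMem (fun h => hx (hAE h)) 1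
  · simp [v, hx]

theorem sobolevCapacity_eq_zero_of_varCapacity_eq_zero {p : ℝ} (hp : 0 ≤ p) {μ : Measure X}
    {A E : Set X} {C : ℝ≥0} (hC : ∀ u : X → EReal, MemNewtonian0 p μ E u →
      (∫⁻ x, (u x).abs ^ p ∂μ) ≤ (C : ℝ≥0∞) * gradEnergy p μ u)
    (hA : varCapacity p μ A E = 0) : sobolevCapacity p μ A = 0 := by
  refine le_antisymm (le_of_forall_pos_le_add fun ε hε => ?_) zero_le
  rw [zero_add]
  obtain ⟨δ, hδ, hδε⟩ := ENNReal.exists_nnreal_pos_mul_lt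
    (a := (C : ℝ≥0∞) + 1) (by simp) hε.ne'
  have hlt : varCapacity p μ A E < δ := by rw [hA]; exact ENNReal.coe_pos.2 hδ
  obtain ⟨u, ⟨hu, huA⟩, huδ⟩ : ∃ u : X → EReal,
      (MemNewtonian0 p μ E u ∧ ∀ x ∈ A, 1 ≤ u x) ∧ gradEnergy p μ u < δ := by
    simpa only [varCapacity, iInf_lt_iff, exists_prop] using hlt
  have hle : newtonianEnergy p μ (fun x => min (u x) 1) ≤ newtonianEnergy p μ u :=
    add_le_add (lintegral_mono fun x => ENNReal.rpow_le_rpow (EReal.abs_min_one_le _) hp)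
      (gradEnergy_min_one_le p μ u)
  calc sobolevCapacity p μ A ≤ newtonianEnergy p μ (fun x => min (u x) 1) :=
        iInf₂_le _ ⟨⟨hu.1.1.min aemeasurable_const, hle.trans_lt hu.1.2⟩,
          fun x hx => min_eq_right (huA x hx)⟩
    _ ≤ newtonianEnergy p μ u := hle
    _ ≤ C * gradEnergy p μ u + gradEnergy p μ u := by
        unfold newtonianEnergy; gcongr; exact hC u hu
    _ = gradEnergy p μ u * (C + 1) := by ring
    _ ≤ δ * (C + 1) := by gcongr
    _ ≤ ε := hδε.le

/-- If `X` supports a `(p,p)`-Poincaré inequality for `N^{1,p}_0` and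
`C_p(X \\ E) > 0`, then for `A ⊆ E`: `C_p(A) = 0 ↔ cap_p(A,E) = 0`. -/
theorem stmt_1 (p : ℝ) (hp : 1 ≤ p) (μ : Measure X)
    (hball : ∀ (x : X) (r : ℝ), 0 < r → 0 < μ (Metric.ball x r) ∧ μ (Metric.ball x r) < ⊤)
    (hPI : PoincareN0 p μ)
    (E : Set X) (hE : Bornology.IsBounded E) (hcE : 0 < sobolevCapacity p μ Eᶜ)
    (A : Set X) (hAE : A ⊆ E) :
    sobolevCapacity p μ A = 0 ↔ varCapacity p μ A E = 0 := by
  have hp0 : 0 < p := zero_lt_one.trans_le hp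
  obtain ⟨C, -, hC⟩ := hPI E hE hcE
  exact ⟨varCapacity_eq_zero_of_sobolevCapacity_eq_zero hp0 hAE,
    sobolevCapacity_eq_zero_of_varCapacity_eq_zero hp0.le hC⟩

end
end

section
/- Continuity of the variational capacity from below: if 1 < p < ∞ and A_1 ⊂ A_2 ⊂ ⋯ ⊂ E, then cap_p(⋃_{i=1}^∞ A_i, E) = lim_{i→∞} cap_p(A_i, E). -/
open MeasureTheory Metric Set Filter
open scoped ENNReal NNReal Topology

noncomputable section

variable {X : Type*} [MetricSpace X] [MeasurableSpace X] [BorelSpace X]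

theorem ugDiff_coe (a b : ℝ) : ugDiff (a : EReal) (b : EReal) = ENNReal.ofReal |a - b| := by
  simp [ugDiff, EReal.abs_def, ← EReal.coe_sub]

theorem ofReal_abs_clamp_sub_le_ugDiff (a b : EReal) :
    ENNReal.ofReal |(a ⊓ 1 ⊔ 0).toReal - (b ⊓ 1 ⊔ 0).toReal| ≤ ugDiff a b := by
  have hcoe (x : ℝ) : ((x : EReal) ⊓ 1 ⊔ 0).toReal = x ⊓ 1 ⊔ 0 := by
    rw [← EReal.coe_one, ← EReal.coe_zero, ← EReal.coe_strictMono.monotone.map_inf,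
      ← EReal.coe_strictMono.monotone.map_sup, EReal.toReal_coe]
  induction a with
  | bot => simp [ugDiff]
  | top => simp [ugDiff]
  | coe a =>
    induction b with
    | bot => simp [ugDiff]
    | top => simp [ugDiff]
    | coe b =>
      rw [ugDiff_coe, hcoe, hcoe]
      refine ENNReal.ofReal_le_ofReal ((abs_max_sub_max_le_abs _ _ _).trans ?_)
      simpa using abs_min_sub_min_le_max a 1 b 1

/-- Countably many exceptional weights can be dominated by a single one. -/
theorem exists_common_weight {ι : Type*} [Countable ι] {p : ℝ} (hp : 0 < p) (μ : Measure X)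
    (ρ : ι → X → ℝ≥0∞) (hρ : ∀ i, Measurable (ρ i)) (hfin : ∀ i, ∫⁻ x, ρ i x ^ p ∂μ < ⊤) :
    ∃ σ : X → ℝ≥0∞, Measurable σ ∧ (∫⁻ x, σ x ^ p ∂μ) < ⊤ ∧
      ∀ γ : Curve X, γ.integral σ ≠ ⊤ → ∀ i, γ.integral (ρ i) ≠ ⊤ := by
  obtain ⟨w, hw, hsum⟩ := ENNReal.exists_pos_tsum_mul_lt_of_countable one_ne_zero
    (fun i => ∫⁻ x, ρ i x ^ p ∂μ) (fun i => (hfin i).ne)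
  refine ⟨fun x => (∑' i, ρ i x ^ p * w i) ^ p⁻¹, ?_, ?_, ?_⟩
  · exact (Measurable.tsum fun i => ((hρ i).pow_const p).mul_const _).pow_const _
  · simp_rw [ENNReal.rpow_inv_rpow hp.ne']
    rw [lintegral_tsum fun i => (((hρ i).pow_const p).mul_const _).aemeasurable]
    simp_rw [lintegral_mul_const _ ((hρ _).pow_const p)]
    exact hsum.trans ENNReal.one_lt_top
  · intro γ hγ i htop
    refine hγ (top_le_iff.mp ?_)
    have hwi : (w i : ℝ≥0∞) ^ p⁻¹ ≠ 0 := by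
      simp [ENNReal.rpow_eq_zero_iff, (hw i).ne']
    calc (⊤ : ℝ≥0∞) = (w i : ℝ≥0∞) ^ p⁻¹ * γ.integral (ρ i) := by
          rw [htop, ENNReal.mul_top hwi]
      _ ≤ ∫⁻ t in Set.Icc (0 : ℝ) γ.len, (w i : ℝ≥0∞) ^ p⁻¹ * ρ i (γ.toFun t) :=
          lintegral_const_mul_le _ _
      _ ≤ _ := by
          refine lintegral_mono fun t => ?_
          calc (w i : ℝ≥0∞) ^ p⁻¹ * ρ i (γ.toFun t)
              = (ρ i (γ.toFun t) ^ p * w i) ^ p⁻¹ := by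
                rw [ENNReal.mul_rpow_of_nonneg _ _ (inv_nonneg.2 hp.le),
                  ENNReal.rpow_rpow_inv hp.ne', mul_comm]
            _ ≤ _ := ENNReal.rpow_le_rpow (ENNReal.le_tsum i) (inv_nonneg.2 hp.le)

/-- `g` is a `p`-weak upper gradient of some `[0, 1]`-valued function that equals `1` on `A` and
vanishes outside `E`. -/
def IsAdmissibleGradient (p : ℝ) (μ : Measure X) (A E : Set X) (g : X → ℝ≥0∞) : Prop :=
  Measurable g ∧ ∃ v : X → ℝ, AEMeasurable v μ ∧ (∀ x, v x ∈ Set.Icc (0 : ℝ) 1) ∧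
    (∀ x ∉ E, v x = 0) ∧ (∀ x ∈ A, v x = 1) ∧
    ∃ ρ : X → ℝ≥0∞, Measurable ρ ∧ (∫⁻ x, ρ x ^ p ∂μ) < ⊤ ∧
      ∀ γ : Curve X, γ.integral ρ ≠ ⊤ →
        ENNReal.ofReal |v (γ.toFun 0) - v (γ.toFun γ.len)| ≤ γ.integral g

theorem IsAdmissibleGradient.anti {p : ℝ} {μ : Measure X} {A B E : Set X} {g : X → ℝ≥0∞}
    (hg : IsAdmissibleGradient p μ B E g) (hAB : A ⊆ B) : IsAdmissibleGradient p μ A E g := by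
  obtain ⟨hm, v, hv, h01, h0, h1, hρ⟩ := hg
  exact ⟨hm, v, hv, h01, h0, fun x hx => h1 x (hAB hx), hρ⟩

theorem exists_isAdmissibleGradient_of_varCapacity_lt {p : ℝ} {μ : Measure X} {A E : Set X}
    {c : ℝ≥0∞} (h : varCapacity p μ A E < c) :
    ∃ g, IsAdmissibleGradient p μ A E g ∧ ∫⁻ x, g x ^ p ∂μ < c := by
  simp only [varCapacity, gradEnergy, iInf_lt_iff] at h
  obtain ⟨u, ⟨⟨⟨hum, -⟩, hu0⟩, hu1⟩, g, ⟨hgm, ρ, hρm, hρ, hρΓ⟩, hgc⟩ := h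
  refine ⟨g, ⟨hgm, fun x => (u x ⊓ 1 ⊔ 0).toReal, ?_, fun x => ⟨?_, ?_⟩, fun x hx => ?_,
    fun x hx => ?_, ρ, hρm, hρ, fun γ hγ => ?_⟩, hgc⟩
  · exact ((hum.inf aemeasurable_const).sup aemeasurable_const).ereal_toReal
  · exact EReal.toReal_nonneg le_sup_right
  · have : (u x ⊓ 1 ⊔ 0) ≤ ((1 : ℝ) : EReal) := by simp
    simpa using EReal.toReal_le_toReal this (ne_bot_of_le_ne_bot (by simp) le_sup_right)
      (EReal.coe_ne_top 1)
  · simp [hu0 x hx]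
  · simp [hu1 x hx]
  · refine (ofReal_abs_clamp_sub_le_ugDiff _ _).trans ?_
    by_contra hcon
    exact hγ (hρΓ γ hcon)

theorem IsAdmissibleGradient.varCapacity_le {p : ℝ} (hp : 0 < p) {μ : Measure X}
    (hball : ∀ (x : X) (r : ℝ), 0 < r → μ (Metric.ball x r) < ⊤)
    {A E : Set X} (hE : Bornology.IsBounded E) {g : X → ℝ≥0∞}
    (hg : IsAdmissibleGradient p μ A E g) :
    varCapacity p μ A E ≤ ∫⁻ x, g x ^ p ∂μ := by
  obtain ⟨hm, v, hv, h01, h0, h1, ρ, hρm, hρ, hρΓ⟩ := hg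
  by_cases htop : ∫⁻ x, g x ^ p ∂μ = ⊤
  · simp [htop]
  have hweak : IsWeakUpperGradient p μ (fun x => (v x : EReal)) g := by
    refine ⟨hm, ρ, hρm, hρ, fun γ hγ => ?_⟩
    by_contra hcon
    exact hγ (by simpa only [UGOn, ugDiff_coe] using hρΓ γ hcon)
  have henergy : gradEnergy p μ (fun x => (v x : EReal)) ≤ ∫⁻ x, g x ^ p ∂μ := iInf₂_le g hweak
  have hLp : ∫⁻ x, (v x : EReal).abs ^ p ∂μ < ⊤ := by
    rcases isEmpty_or_nonempty X with hX | ⟨⟨x₀⟩⟩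
    · simp [lintegral_of_isEmpty]
    obtain ⟨r, hr, hEr⟩ := hE.subset_ball_lt 0 x₀
    calc ∫⁻ x, (v x : EReal).abs ^ p ∂μ
        ≤ ∫⁻ x, (Metric.ball x₀ r).indicator 1 x ∂μ := by
          refine lintegral_mono fun x => ?_
          by_cases hx : x ∈ Metric.ball x₀ r
          · rw [Set.indicator_of_mem hx, EReal.abs_def]
            refine (ENNReal.rpow_le_rpow (z := p) (?_ : _ ≤ (1 : ℝ≥0∞)) hp.le).trans (by simp)
            rw [ENNReal.ofReal_le_one, abs_of_nonneg (h01 x).1]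
            exact (h01 x).2
          · simp [h0 x fun h => hx (hEr h), hp]
      _ = μ (Metric.ball x₀ r) := lintegral_indicator_one measurableSet_ball
      _ < ⊤ := hball x₀ r hr
  refine (iInf₂_le (fun x => (v x : EReal)) ⟨⟨⟨hv.coe_real_ereal, ?_⟩, fun x hx => ?_⟩,
    fun x hx => ?_⟩).trans henergy
  · exact ENNReal.add_lt_top.2 ⟨hLp, henergy.trans_lt (lt_top_iff_ne_top.2 htop)⟩
  · simp [h0 x hx]
  · simp [h1 x hx]

theorem IsAdmissibleGradient.midpoint {p : ℝ} (hp : 0 < p) {μ : Measure X} {A E : Set X}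
    {f g : X → ℝ≥0∞} (hf : IsAdmissibleGradient p μ A E f)
    (hg : IsAdmissibleGradient p μ A E g) :
    IsAdmissibleGradient p μ A E (fun x => 2⁻¹ * (f x + g x)) := by
  obtain ⟨hfm, v, hv, hv01, hv0, hv1, ρ, hρm, hρ, hρΓ⟩ := hf
  obtain ⟨hgm, w, hw, hw01, hw0, hw1, σ, hσm, hσ, hσΓ⟩ := hg
  obtain ⟨τ, hτm, hτ, hτΓ⟩ := exists_common_weight hp μ (fun b : Bool => cond b ρ σ)
    (by rintro (_ | _) <;> assumption) (by rintro (_ | _) <;> assumption)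
  refine ⟨(hfm.add hgm).const_mul _, fun x => 2⁻¹ * (v x + w x), (hv.add hw).const_mul _,
    fun x => ⟨?_, ?_⟩, fun x hx => ?_, fun x hx => ?_, τ, hτm, hτ, fun γ hγ => ?_⟩
  · linarith [(hv01 x).1, (hw01 x).1]
  · linarith [(hv01 x).2, (hw01 x).2]
  · simp [hv0 x hx, hw0 x hx]
  · norm_num [hv1 x hx, hw1 x hx]
  · set a := γ.toFun 0
    set b := γ.toFun γ.len
    calc ENNReal.ofReal |2⁻¹ * (v a + w a) - 2⁻¹ * (v b + w b)|
        = 2⁻¹ * ENNReal.ofReal |(v a - v b) + (w a - w b)| := by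
          rw [← mul_sub, abs_mul, ENNReal.ofReal_mul (abs_nonneg _), add_sub_add_comm]
          congr 1
          rw [abs_of_pos (by norm_num), ENNReal.ofReal_inv_of_pos two_pos]
          simp
      _ ≤ 2⁻¹ * (ENNReal.ofReal |v a - v b| + ENNReal.ofReal |w a - w b|) := by
          rw [← ENNReal.ofReal_add (abs_nonneg _) (abs_nonneg _)]
          gcongr
          exact abs_add_le _ _
      _ ≤ 2⁻¹ * (γ.integral f + γ.integral g) := by
          gcongr
          · exact hρΓ γ (hτΓ γ hγ true)
          · exact hσΓ γ (hτΓ γ hγ false)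
      _ ≤ 2⁻¹ * ∫⁻ t in Set.Icc (0 : ℝ) γ.len, (f (γ.toFun t) + g (γ.toFun t)) := by
          gcongr
          exact le_lintegral_add _ _
      _ ≤ _ := lintegral_const_mul_le _ _

theorem IsAdmissibleGradient.iSup {p : ℝ} (hp : 0 < p) {μ : Measure X} {A : ℕ → Set X}
    {E : Set X} {g : ℕ → X → ℝ≥0∞} (hg : ∀ i, IsAdmissibleGradient p μ (A i) E (g i)) :
    IsAdmissibleGradient p μ (⋃ i, A i) E (fun x => ⨆ i, g i x) := by
  choose hm v hv h01 h0 h1 ρ hρm hρ hρΓ using hg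
  obtain ⟨τ, hτm, hτ, hτΓ⟩ := exists_common_weight hp μ ρ hρm hρ
  have hbdd (x : X) : BddAbove (Set.range fun i => v i x) :=
    ⟨1, by rintro _ ⟨i, rfl⟩; exact (h01 i x).2⟩
  refine ⟨Measurable.iSup hm, fun x => ⨆ i, v i x, AEMeasurable.iSup hv,
    fun x => ⟨?_, ?_⟩, fun x hx => ?_, fun x hx => ?_, τ, hτm, hτ, fun γ hγ => ?_⟩
  · exact Real.iSup_nonneg fun i => (h01 i x).1
  · exact ciSup_le fun i => (h01 i x).2
  · simp [h0 _ x hx]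
  · obtain ⟨i, hi⟩ := Set.mem_iUnion.1 hx
    exact le_antisymm (ciSup_le fun j => (h01 j x).2) ((h1 i x hi).symm.le.trans
      (le_ciSup (hbdd x) i))
  · by_cases htop : γ.integral (fun x => ⨆ i, g i x) = ⊤
    · simp [htop]
    have hle (i : ℕ) : |v i (γ.toFun 0) - v i (γ.toFun γ.len)|
        ≤ (γ.integral fun x => ⨆ i, g i x).toReal := by
      rw [← ENNReal.ofReal_le_iff_le_toReal htop]
      exact (hρΓ i γ (hτΓ γ hγ i)).trans
        (lintegral_mono fun t => le_iSup (fun i => g i (γ.toFun t)) i)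
    rw [ENNReal.ofReal_le_iff_le_toReal htop, abs_sub_le_iff, sub_le_iff_le_add,
      sub_le_iff_le_add]
    refine ⟨ciSup_le fun i => ?_, ciSup_le fun i => ?_⟩
    · linarith [(abs_sub_le_iff.1 (hle i)).1, le_ciSup (hbdd (γ.toFun γ.len)) i]
    · linarith [(abs_sub_le_iff.1 (hle i)).2, le_ciSup (hbdd (γ.toFun 0)) i]

/-- A quantitative form of the strict convexity of `t ↦ t ^ p`. -/
theorem exists_rpow_sub_rpow_le {p : ℝ} (hp : 1 < p) {ε : ℝ} (hε : 0 < ε) :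
    ∃ K : ℝ, 0 ≤ K ∧ ∀ a b : ℝ, 0 ≤ a → 0 ≤ b →
      b ^ p - a ^ p ≤ ε * (a ^ p + b ^ p) + K * ((a ^ p + b ^ p) / 2 - ((a + b) / 2) ^ p) ∧
      ((a + b) / 2) ^ p ≤ (a ^ p + b ^ p) / 2 := by
  have hp0 : 0 < p := one_pos.trans hp
  have hconv (a b : ℝ) (ha : 0 ≤ a) (hb : 0 ≤ b) : ((a + b) / 2) ^ p ≤ (a ^ p + b ^ p) / 2 := by
    have := (convexOn_rpow hp.le).2 (Set.mem_Ici.2 ha) (Set.mem_Ici.2 hb)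
      (by norm_num : (0 : ℝ) ≤ 2⁻¹) (by norm_num : (0 : ℝ) ≤ 2⁻¹) (by norm_num)
    simp only [smul_eq_mul] at this
    rw [← mul_add, ← mul_add] at this
    rwa [div_eq_inv_mul, div_eq_inv_mul]
  have hcont : Continuous fun x : ℝ => x ^ p := Real.continuous_rpow_const hp0.le
  have hcont' : Continuous fun x : ℝ => (1 - x) ^ p := hcont.comp (by fun_prop)
  obtain ⟨K, hK, h⟩ : ∃ K : ℝ, 0 ≤ K ∧ ∀ x ∈ Set.Icc (0 : ℝ) 1,
      (1 - x) ^ p - x ^ p ≤ ε * (x ^ p + (1 - x) ^ p) +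
        K * ((x ^ p + (1 - x) ^ p) / 2 - (1 / 2) ^ p) := by
    set S := Set.Icc (0 : ℝ) 1 ∩ {x | ε * (x ^ p + (1 - x) ^ p) ≤ (1 - x) ^ p - x ^ p}
    have hScomp : IsCompact S := isCompact_Icc.inter_right
      (isClosed_le (continuous_const.mul (hcont.add hcont')) (hcont'.sub hcont))
    have hd (x : ℝ) (hx : x ∈ Set.Icc (0 : ℝ) 1) :
        0 ≤ (x ^ p + (1 - x) ^ p) / 2 - (1 / 2) ^ p := by
      have := hconv x (1 - x) hx.1 (by linarith [hx.2])
      rw [add_sub_cancel] at this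
      linarith
    rcases S.eq_empty_or_nonempty with hemp | hne
    · refine ⟨0, le_rfl, fun x hx => ?_⟩
      by_contra! hcon
      have : x ∈ S := ⟨hx, by simpa using hcon.le⟩
      simp [hemp] at this
    · obtain ⟨y, hy, hmin⟩ := hScomp.exists_isMinOn hne
        (f := fun x : ℝ => (x ^ p + (1 - x) ^ p) / 2 - (1 / 2) ^ p)
        (((hcont.add hcont').div_const 2).sub continuous_const).continuousOn
      have hypos : 0 < (y ^ p + (1 - y) ^ p) / 2 - (1 / 2) ^ p := by
        have hne' : y ≠ 1 - y := by
          intro heq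
          have h2 := hy.2
          rw [Set.mem_ofPred_eq, ← heq, sub_self] at h2
          have : 0 < y ^ p := Real.rpow_pos_of_pos (by linarith) _
          nlinarith [mul_pos hε this]
        have := (strictConvexOn_rpow hp).2 (Set.mem_Ici.2 hy.1.1)
          (Set.mem_Ici.2 (sub_nonneg.2 hy.1.2)) hne'
          (by norm_num : (0 : ℝ) < 2⁻¹) (by norm_num : (0 : ℝ) < 2⁻¹) (by norm_num)
        simp only [smul_eq_mul] at this
        rw [← mul_add, ← mul_add, add_sub_cancel] at this
        rw [sub_pos, div_eq_inv_mul, div_eq_inv_mul]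
        exact this
      refine ⟨((y ^ p + (1 - y) ^ p) / 2 - (1 / 2) ^ p)⁻¹, inv_nonneg.2 hypos.le,
        fun x hx => ?_⟩
      have hxp : 0 ≤ x ^ p := Real.rpow_nonneg hx.1 _
      have hx' : 0 ≤ 1 - x := sub_nonneg.2 hx.2
      have hxp' : 0 ≤ (1 - x) ^ p := Real.rpow_nonneg hx' _
      have hxp1 : (1 - x) ^ p ≤ 1 := Real.rpow_le_one hx' (by linarith [hx.1]) hp0.le
      by_cases hxS : x ∈ S
      · have h1 : 1 ≤ ((y ^ p + (1 - y) ^ p) / 2 - (1 / 2) ^ p)⁻¹ *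
            ((x ^ p + (1 - x) ^ p) / 2 - (1 / 2) ^ p) := by
          rw [← div_eq_inv_mul, one_le_div hypos]
          exact hmin hxS
        have := mul_nonneg hε.le (add_nonneg hxp hxp')
        linarith
      · have h1 : (1 - x) ^ p - x ^ p < ε * (x ^ p + (1 - x) ^ p) := by
          by_contra! hcon
          exact hxS ⟨hx, hcon⟩
        have := mul_nonneg (inv_nonneg.2 hypos.le) (hd x hx)
        linarith
  refine ⟨K, hK, fun a b ha hb => ⟨?_, hconv a b ha hb⟩⟩
  rcases (add_nonneg ha hb).eq_or_lt with h0 | hpos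
  · obtain rfl : a = 0 := by linarith
    obtain rfl : b = 0 := by linarith
    simp [Real.zero_rpow hp0.ne']
  · have hx := h (a / (a + b)) ⟨by positivity, (div_le_one hpos).2 (by linarith)⟩
    have h1 : 1 - a / (a + b) = b / (a + b) := by field_simp; ring
    have hs : 0 < (a + b) ^ p := Real.rpow_pos_of_pos hpos _
    rw [h1, Real.div_rpow ha hpos.le, Real.div_rpow hb hpos.le,
      Real.div_rpow one_pos.le two_pos.le, Real.one_rpow] at hx
    rw [Real.div_rpow hpos.le two_pos.le]
    have := mul_le_mul_of_nonneg_right hx hs.le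
    field_simp at this ⊢
    linarith

theorem ENNReal.exists_rpow_tsub_rpow_add_le {p : ℝ} (hp : 1 < p) {ε : ℝ≥0} (hε : 0 < ε) :
    ∃ K : ℝ≥0, ∀ a b : ℝ≥0∞,
      (b ^ p - a ^ p) + K * (2⁻¹ * (a + b)) ^ p ≤ ε * (a ^ p + b ^ p) +
        K * (2⁻¹ * (a ^ p + b ^ p)) := by
  have hp0 : 0 < p := one_pos.trans hp
  obtain ⟨K, hK, h⟩ := exists_rpow_sub_rpow_le hp (NNReal.coe_pos.2 hε)
  lift K to ℝ≥0 using hK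
  refine ⟨K, fun a b => ?_⟩
  have hε' : (ε : ℝ≥0∞) ≠ 0 := by simpa using hε.ne'
  induction a with
  | top => simp [ENNReal.top_rpow_of_pos hp0, ENNReal.mul_top hε']
  | coe a =>
    induction b with
    | top => simp [ENNReal.top_rpow_of_pos hp0, ENNReal.mul_top hε']
    | coe b =>
      have h2 : (2⁻¹ : ℝ≥0∞) = ((2⁻¹ : ℝ≥0) : ℝ≥0∞) := by simp
      rw [h2]
      simp only [← ENNReal.coe_add, ← ENNReal.coe_mul, ← ENNReal.coe_rpow_of_nonneg _ hp0.le,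
        ← ENNReal.coe_sub, ENNReal.coe_le_coe]
      obtain ⟨hab, hcv⟩ := h a b a.2 b.2
      rw [← NNReal.coe_le_coe]
      rcases le_total (a ^ p) (b ^ p) with hle | hle
      · push_cast [NNReal.coe_sub hle]
        simp only [← div_eq_inv_mul]
        linarith
      · rw [tsub_eq_zero_of_le hle]
        push_cast
        simp only [← div_eq_inv_mul]
        have h1 := mul_le_mul_of_nonneg_left hcv K.2
        have h3 : (0 : ℝ) ≤ ε * ((a : ℝ) ^ p + (b : ℝ) ^ p) := by positivity
        simp only [NNReal.val_eq_coe] at h1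
        linarith

/-- Almost minimal admissible gradients for nested sets of almost equal capacity have almost
equal `p`-th powers. -/
theorem exists_lintegral_rpow_tsub_le {p : ℝ} (hp : 1 < p) {μ : Measure X}
    (hball : ∀ (x : X) (r : ℝ), 0 < r → μ (Metric.ball x r) < ⊤)
    {E : Set X} (hE : Bornology.IsBounded E) (L : ℝ≥0) {δ : ℝ≥0} (hδ : 0 < δ) :
    ∃ θ : ℝ≥0, 0 < θ ∧ ∀ (A B : Set X) (f g : X → ℝ≥0∞), A ⊆ B →
      IsAdmissibleGradient p μ A E f → IsAdmissibleGradient p μ B E g →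
      (L : ℝ≥0∞) ≤ varCapacity p μ A E + θ → ∫⁻ x, f x ^ p ∂μ ≤ L + θ →
      ∫⁻ x, g x ^ p ∂μ ≤ L + θ → ∫⁻ x, (g x ^ p - f x ^ p) ∂μ ≤ δ := by
  have hp0 : 0 < p := one_pos.trans hp
  set ε : ℝ≥0 := δ / (4 * (L + 1))
  have hε : 0 < ε := by positivity
  obtain ⟨K, hK⟩ := ENNReal.exists_rpow_tsub_rpow_add_le hp hε
  set θ : ℝ≥0 := min 1 (δ / (4 * (K + 1)))
  have hθ : 0 < θ := lt_min one_pos (by positivity)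
  refine ⟨θ, hθ, fun A B f g hAB hf hg hL hfL hgL => ?_⟩
  have hmid := (hf.midpoint hp0 (hg.anti hAB)).varCapacity_le hp0 hball hE
  have hfm : Measurable fun x => f x ^ p := hf.1.pow_const p
  have hgm : Measurable fun x => g x ^ p := hg.1.pow_const p
  have hfgm : Measurable fun x => f x ^ p + g x ^ p := hfm.add hgm
  have hmm : Measurable fun x => (2⁻¹ * (f x + g x)) ^ p :=
    ((hf.1.add hg.1).const_mul _).pow_const p
  have hdm : Measurable fun x => g x ^ p - f x ^ p := hgm.sub hfm
  have hint : ∫⁻ x, (g x ^ p - f x ^ p) ∂μ + K * ∫⁻ x, (2⁻¹ * (f x + g x)) ^ p ∂μ ≤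
      ε * (∫⁻ x, f x ^ p ∂μ + ∫⁻ x, g x ^ p ∂μ) +
        K * (2⁻¹ * (∫⁻ x, f x ^ p ∂μ + ∫⁻ x, g x ^ p ∂μ)) := by
    rw [← lintegral_add_left hfm, ← lintegral_const_mul _ hfgm, ← lintegral_const_mul _ hfgm,
      ← lintegral_const_mul _ hmm, ← lintegral_const_mul _ (hfgm.const_mul _),
      ← lintegral_add_left hdm, ← lintegral_add_left (hfgm.const_mul _)]
    exact lintegral_mono fun x => hK (f x) (g x)
  have hKL : (K * L : ℝ≥0∞) ≠ ⊤ := by finiteness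
  refine (ENNReal.add_le_add_iff_right hKL).1 ?_
  calc ∫⁻ x, (g x ^ p - f x ^ p) ∂μ + K * L
      ≤ ∫⁻ x, (g x ^ p - f x ^ p) ∂μ +
          K * (∫⁻ x, (2⁻¹ * (f x + g x)) ^ p ∂μ + θ) := by
        gcongr
        exact hL.trans (by gcongr)
    _ ≤ ε * ((L + θ) + (L + θ)) + K * (2⁻¹ * ((L + θ) + (L + θ))) + K * θ := by
        rw [mul_add, ← add_assoc]
        exact add_le_add_left (hint.trans (by gcongr)) _
    _ ≤ δ + K * L := by
        have h2 : (2⁻¹ : ℝ≥0∞) = ((2⁻¹ : ℝ≥0) : ℝ≥0∞) := by simp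
        rw [h2]
        norm_cast
        rw [← NNReal.coe_le_coe]
        push_cast
        have hθ1 : (θ : ℝ) ≤ 1 := by exact_mod_cast min_le_left _ _
        have hθ2 : (θ : ℝ) * (4 * (K + 1)) ≤ δ := by
          have : θ ≤ δ / (4 * (K + 1)) := min_le_right _ _
          rw [le_div_iff₀ (by positivity)] at this
          exact_mod_cast this
        have hε2 : (ε : ℝ) * (4 * (L + 1)) = δ := by
          have : ε * (4 * (L + 1)) = δ := div_mul_cancel₀ _ (by positivity)
          exact_mod_cast this
        have hθ0 : (0 : ℝ) ≤ θ := θ.2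
        have hε0 : (0 : ℝ) ≤ ε := ε.2
        nlinarith [mul_le_mul_of_nonneg_left hθ1 hε0]

theorem varCapacity_mono (p : ℝ) (μ : Measure X) {A B : Set X} (E : Set X) (h : A ⊆ B) :
    varCapacity p μ A E ≤ varCapacity p μ B E :=
  le_iInf₂ fun u hu => iInf₂_le u ⟨hu.1, fun x hx => hu.2 x (h hx)⟩

theorem ENNReal.iSup_rpow_le_add_tsum_tsub {p : ℝ} (hp : 0 < p) (a : ℕ → ℝ≥0∞) :
    (⨆ i, a i) ^ p ≤ a 0 ^ p + ∑' i, (a (i + 1) ^ p - a i ^ p) := by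
  rw [← ENNReal.le_rpow_inv_iff hp]
  refine iSup_le fun n => (ENNReal.le_rpow_inv_iff hp).2 ?_
  have h : a n ^ p ≤ a 0 ^ p + ∑ i ∈ Finset.range n, (a (i + 1) ^ p - a i ^ p) := by
    induction n with
    | zero => simp
    | succ n ih =>
      rw [Finset.sum_range_succ, ← add_assoc]
      exact le_add_tsub.trans (by gcongr)
  exact h.trans (by gcongr; exact ENNReal.sum_le_tsum _)

theorem varCapacity_iUnion_le {p : ℝ} (hp : 1 < p) {μ : Measure X}
    (hball : ∀ (x : X) (r : ℝ), 0 < r → μ (Metric.ball x r) < ⊤)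
    {E : Set X} (hE : Bornology.IsBounded E) {A : ℕ → Set X} (hmono : Monotone A) :
    varCapacity p μ (⋃ i, A i) E ≤ ⨆ i, varCapacity p μ (A i) E := by
  have hp0 : 0 < p := one_pos.trans hp
  set c : ℕ → ℝ≥0∞ := fun i => varCapacity p μ (A i) E
  by_cases htop : (⨆ i, c i) = ⊤
  · simp [htop]
  lift (⨆ i, c i) to ℝ≥0 using htop with L hL
  have hcL (i : ℕ) : c i ≤ L := hL ▸ le_iSup c i
  have hclim : Tendsto c atTop (𝓝 (L : ℝ≥0∞)) := by
    rw [hL]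
    exact tendsto_atTop_iSup fun i j hij => varCapacity_mono p μ E (hmono hij)
  have hex (i : ℕ) : ∃ g, IsAdmissibleGradient p μ (A i) E g ∧
      ∫⁻ x, g x ^ p ∂μ < c i + ((i : ℝ≥0∞) + 1)⁻¹ :=
    exists_isAdmissibleGradient_of_varCapacity_lt
      (ENNReal.lt_add_right ((hcL i).trans_lt ENNReal.coe_lt_top).ne (by simp))
  choose g hg hgc using hex
  have hlow (θ : ℝ≥0) (hθ : 0 < θ) : ∀ᶠ i in atTop, (L : ℝ≥0∞) ≤ c i + θ := by
    have h := hclim.add_const (θ : ℝ≥0∞)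
    filter_upwards [h.eventually_const_lt
      (ENNReal.lt_add_right ENNReal.coe_ne_top (by simpa using hθ.ne'))] with i hi using hi.le
  have hhigh (θ : ℝ≥0) (hθ : 0 < θ) : ∀ᶠ i in atTop, ∫⁻ x, g i x ^ p ∂μ ≤ L + θ := by
    have h : Tendsto (fun i : ℕ => ((i : ℝ≥0∞) + 1)⁻¹) atTop (𝓝 0) := by
      have := (tendsto_add_atTop_iff_nat 1).2 ENNReal.tendsto_inv_nat_nhds_zero
      simpa using this
    filter_upwards [h.eventually_lt_const (by simpa using hθ : (0 : ℝ≥0∞) < θ)] with i hi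
    exact (hgc i).le.trans (add_le_add (hcL i) hi.le)
  refine ENNReal.le_of_forall_pos_le_add fun η hη _ => ?_
  obtain ⟨δ, hδ, hδsum⟩ := ENNReal.exists_pos_sum_of_countable
    (ENNReal.coe_ne_zero.2 (half_pos hη).ne') ℕ
  have hext (n : ℕ) : ∃ N, ∀ k ≥ N, ∫⁻ x, g k x ^ p ∂μ ≤ L + (η / 2 : ℝ≥0) ∧
      ∀ l ≥ k, ∫⁻ x, (g l x ^ p - g k x ^ p) ∂μ ≤ δ n := by
    obtain ⟨θ, hθ, hθδ⟩ := exists_lintegral_rpow_tsub_le hp hball hE L (hδ n)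
    obtain ⟨N, hN⟩ := eventually_atTop.1
      ((hlow θ hθ).and ((hhigh θ hθ).and (hhigh _ (half_pos hη))))
    exact ⟨N, fun k hk => ⟨(hN k hk).2.2, fun l hl => hθδ (A k) (A l) (g k) (g l) (hmono hl)
      (hg k) (hg l) (hN k hk).1 (hN k hk).2.1 (hN l (hk.trans hl)).2.1⟩⟩
  obtain ⟨φ, hφ, hφP⟩ := extraction_forall_of_eventually' hext
  have hm (i : ℕ) : Measurable fun x => g i x ^ p := (hg i).1.pow_const p
  have hdm (i : ℕ) : Measurable fun x => g (φ (i + 1)) x ^ p - g (φ i) x ^ p :=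
    (hm _).sub (hm _)
  calc varCapacity p μ (⋃ i, A i) E
      ≤ varCapacity p μ (⋃ i, A (φ i)) E :=
        varCapacity_mono p μ E (Set.iUnion_mono fun i => hmono (hφ.id_le i))
    _ ≤ ∫⁻ x, (⨆ i, g (φ i) x) ^ p ∂μ :=
        (IsAdmissibleGradient.iSup hp0 fun i => hg (φ i)).varCapacity_le hp0 hball hE
    _ ≤ ∫⁻ x, (g (φ 0) x ^ p + ∑' i, (g (φ (i + 1)) x ^ p - g (φ i) x ^ p)) ∂μ :=
        lintegral_mono fun x => ENNReal.iSup_rpow_le_add_tsum_tsub hp0 fun i => g (φ i) x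
    _ = ∫⁻ x, g (φ 0) x ^ p ∂μ +
          ∑' i, ∫⁻ x, (g (φ (i + 1)) x ^ p - g (φ i) x ^ p) ∂μ := by
        rw [lintegral_add_left (hm _), lintegral_tsum fun i => (hdm i).aemeasurable]
    _ ≤ (L + (η / 2 : ℝ≥0)) + ∑' i, (δ i : ℝ≥0∞) := by
        gcongr with i
        · exact (hφP 0).1
        · exact (hφP i).2 _ (hφ (Nat.lt_succ_self i)).le
    _ ≤ (L + (η / 2 : ℝ≥0)) + (η / 2 : ℝ≥0) := by gcongr
    _ = L + η := by
        rw [add_assoc, ← ENNReal.coe_add, add_halves]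

/-- Continuity from below for `1 < p < ∞` and increasing sets. -/
theorem stmt_7 (p : ℝ) (hp : 1 < p) (μ : Measure X)
    (hball : ∀ (x : X) (r : ℝ), 0 < r → 0 < μ (Metric.ball x r) ∧ μ (Metric.ball x r) < ⊤)
    (E : Set X) (hE : Bornology.IsBounded E)
    (A : ℕ → Set X) (hmono : ∀ i, A i ⊆ A (i + 1)) (hA : ∀ i, A i ⊆ E) :
    Filter.Tendsto (fun i => varCapacity p μ (A i) E) Filter.atTop
      (𝓝 (varCapacity p μ (⋃ i, A i) E)) := by
  have hA' : Monotone A := monotone_nat_of_le_succ hmono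
  rw [show varCapacity p μ (⋃ i, A i) E = ⨆ i, varCapacity p μ (A i) E from
    le_antisymm (varCapacity_iUnion_le hp (fun x r hr => (hball x r hr).2) hE hA')
      (iSup_le fun i => varCapacity_mono p μ E (Set.subset_iUnion A i))]
  exact tendsto_atTop_iSup fun i j hij => varCapacity_mono p μ E (hA' hij)

end
end
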